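/- arXiv:2310.07318 — 2 statements merged into one kernel-verified Lean document; each statement's English description precedes it below -/
import Mathlib

section
/- The weight-5 multiple zeta values satisfy −2ζ(1,4) − ζ(2,3) − 3ζ(1,1,3) + ζ(2,1,2) = 0 and 2ζ(1,4) − ζ(3,2) + 3ζ(1,1,3) + ζ(1,2,2) = 0. -/
/-- Multiple zeta value `ζ(k₁,…,k_r) = Σ_{0<m₁<⋯<m_r} ∏ mᵢ^{-kᵢ}`. -/
noncomputable def mzv (k : List ℕ) : ℝ :=
  ∑' m : {f : Fin k.length → ℕ+ // StrictMono f},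
    ∏ i : Fin k.length, ((m.1 i : ℝ) ^ (k.get i))⁻¹

open scoped ENNReal NNReal
open Filter Topology

namespace MzvAux

/-- reciprocal weight, zero at zero -/
noncomputable def w (n : ℕ) : ℝ≥0∞ := (((n : ℝ≥0)⁻¹ : ℝ≥0) : ℝ≥0∞)

/-- Seki–Yamamoto connector `m! n! / (m+n)!` -/
noncomputable def c (m n : ℕ) : ℝ≥0∞ := (((((m + n).choose m : ℕ) : ℝ≥0)⁻¹ : ℝ≥0) : ℝ≥0∞)

noncomputable def D (u : ℕ → ℝ≥0∞) (n : ℕ) : ℝ≥0∞ := w n * u n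
noncomputable def S (u : ℕ → ℝ≥0∞) (n : ℕ) : ℝ≥0∞ := w n * ∑ k ∈ Finset.range n, u k
noncomputable def P (u v : ℕ → ℝ≥0∞) : ℝ≥0∞ := ∑' m, ∑' n, u m * v n * c m n
noncomputable def dl (n : ℕ) : ℝ≥0∞ := if n = 0 then 1 else 0

lemma w_zero : w 0 = 0 := by simp [w]
lemma D_zero (u) : D u 0 = 0 := by simp [D, w_zero]
lemma S_zero (u) : S u 0 = 0 := by simp [S]

lemma c_symm (m n : ℕ) : c m n = c n m := by
  unfold c
  rw [add_comm m n, Nat.choose_symm_add]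

lemma hasSum_tele (f : ℕ → ℝ) (hf : Antitone f) (h0 : Tendsto f atTop (𝓝 0)) :
    HasSum (fun b => f b - f (b + 1)) (f 0) := by
  rw [hasSum_iff_tendsto_nat_of_nonneg (fun i => sub_nonneg.2 (hf (Nat.le_succ i)))]
  simp_rw [Finset.sum_range_sub']
  simpa using h0.const_sub (f 0)

lemma tsum_split (g : ℕ → ℝ≥0∞) (k : ℕ) :
    ∑' n, g n = ∑ n ∈ Finset.range k, g n + ∑' b, g (k + b) := by
  rw [← ENNReal.summable.sum_add_tsum_nat_add' (k := k) (f := g)]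
  simp [add_comm]

lemma L (f g : ℕ → ℝ≥0∞) :
    ∑' n, g n * ∑ k ∈ Finset.range n, f k = ∑' k, f k * ∑' b, g (k + b + 1) := by
  have h1 : ∀ n, g n * ∑ k ∈ Finset.range n, f k = ∑' k, if k < n then f k * g n else 0 := by
    intro n
    rw [tsum_eq_sum (s := Finset.range n), Finset.mul_sum]
    · refine Finset.sum_congr rfl fun k hk => ?_
      rw [if_pos (Finset.mem_range.1 hk), mul_comm]
    · intro k hk
      rw [if_neg (by simpa using hk)]
  simp_rw [h1]
  rw [ENNReal.tsum_comm]
  refine tsum_congr fun k => ?_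
  rw [tsum_split _ (k + 1), Finset.sum_eq_zero, zero_add, ← ENNReal.tsum_mul_left]
  · refine tsum_congr fun b => ?_
    rw [if_pos (by omega)]
    congr 2; omega
  · intro n hn
    rw [if_neg]
    have := Finset.mem_range.1 hn
    omega

/-- real connector -/
noncomputable def cr (m n : ℕ) : ℝ := (((m + n).choose m : ℕ) : ℝ)⁻¹

lemma choose_pos' (m n : ℕ) : (0 : ℝ) < ((m + n).choose m : ℕ) := by
  exact_mod_cast Nat.choose_pos (Nat.le_add_right m n)

lemma cr_step (m k : ℕ) :
    ((k : ℝ) + 1)⁻¹ * cr (m+1) (k + 1) =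
      ((m : ℝ) + 1)⁻¹ * cr (m+1) k - ((m : ℝ) + 1)⁻¹ * cr (m+1) (k + 1) := by
  have h : ((m + 1 + (k+1)).choose (m+1) : ℝ) * (k + 1) = ((m + 1 + k).choose (m+1) : ℝ) * (m + 1 + k + 1) := by
    have := Nat.choose_mul_succ_eq (m + 1 + k) (m + 1)
    have e : m + 1 + k + 1 - (m + 1) = k + 1 := by omega
    rw [e] at this
    exact_mod_cast this.symm
  have p1 := choose_pos' (m+1) k
  have p2 := choose_pos' (m+1) (k+1)
  unfold cr
  field_simp
  linarith

lemma cr_le (m k : ℕ) : cr (m+1) k ≤ ((k : ℝ) + 1)⁻¹ := by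
  unfold cr
  apply inv_anti₀ (by positivity)
  have : k + 1 ≤ (m + 1 + k).choose (m + 1) := by
    have h1 : (m + 1 + k).choose (m+1) = (m+1+k).choose k := Nat.choose_symm_add
    rw [h1]
    calc k + 1 = (1 + k).choose k := by rw [add_comm 1 k]; simp
      _ ≤ _ := Nat.choose_le_choose k (by omega)
  exact_mod_cast this

lemma T (m k : ℕ) (hm : m ≠ 0) : ∑' b, w (k + b + 1) * c m (k + b + 1) = w m * c m k := by
  obtain ⟨m, rfl⟩ := Nat.exists_eq_succ_of_ne_zero hm
  have hs : HasSum (fun b => ((m : ℝ) + 1)⁻¹ * cr (m+1) (k + b) - ((m : ℝ) + 1)⁻¹ * cr (m+1) (k + (b + 1)))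
      (((m : ℝ) + 1)⁻¹ * cr (m+1) (k + 0)) := by
    apply hasSum_tele (fun b => ((m : ℝ) + 1)⁻¹ * cr (m+1) (k + b))
    · apply antitone_nat_of_succ_le
      intro b
      have := cr_step m (k + b)
      have h2 : 0 ≤ (((k + b : ℕ) : ℝ) + 1)⁻¹ * cr (m+1) (k + b + 1) := by
        unfold cr; positivity
      rw [← add_assoc]
      linarith
    · rw [← mul_zero ((m : ℝ) + 1)⁻¹]
      apply Tendsto.const_mul
      have hh : Tendsto (fun b : ℕ => cr (m+1) b) atTop (𝓝 0) := by
        apply squeeze_zero (fun b => by unfold cr; positivity) (cr_le m)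
        simpa [one_div] using tendsto_one_div_add_atTop_nhds_zero_nat (𝕜 := ℝ)
      have h3 := (tendsto_add_atTop_iff_nat (f := fun b : ℕ => cr (m+1) b) k).2 hh
      simpa [add_comm] using h3
  have hs2 : HasSum (fun b => (((k + b : ℕ) : ℝ≥0) + 1)⁻¹ * (((m + 1 + (k + b + 1)).choose (m+1) : ℕ) : ℝ≥0)⁻¹)
      (((m : ℝ≥0) + 1)⁻¹ * (((m + 1 + k).choose (m+1) : ℕ) : ℝ≥0)⁻¹) := by
    rw [← NNReal.hasSum_coe]
    convert hs using 1
    · funext b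
      have := cr_step m (k + b)
      rw [← add_assoc k b 1, ← this]
      simp [cr]
    · simp [cr]
  have := (ENNReal.hasSum_coe.2 hs2).tsum_eq
  simp only [w, c, ← ENNReal.coe_mul]
  push_cast at this ⊢
  exact this

lemma P_symm (u v) : P u v = P v u := by
  unfold P
  rw [ENNReal.tsum_comm]
  refine tsum_congr fun m => tsum_congr fun n => ?_
  rw [c_symm, mul_comm (u n)]

lemma transport (u v) (hu : u 0 = 0) : P (D u) v = P u (S v) := by
  unfold P
  refine tsum_congr fun m => ?_
  by_cases hm : m = 0
  · subst hm; simp [hu, D]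
  have h1 : ∀ n, u m * S v n * c m n = u m * ((w n * c m n) * ∑ k ∈ Finset.range n, v k) := by
    intro n; unfold S; ring
  simp_rw [h1]
  rw [ENNReal.tsum_mul_left, L v (fun n => w n * c m n), ← ENNReal.tsum_mul_left]
  refine tsum_congr fun k => ?_
  rw [T m k hm]
  unfold D
  ring

lemma transport' (u v) (hv : v 0 = 0) : P (S u) v = P u (D v) := by
  rw [P_symm, ← transport v u hv, P_symm]

lemma P_dl (u) : P u dl = ∑' m, u m := by
  unfold P
  refine tsum_congr fun m => ?_
  rw [tsum_eq_single 0]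
  · simp [dl, c]
  · intro b hb; simp [dl, hb]

lemma dual32 : ∑' n, D (S (D (D (S dl)))) n = ∑' n, D (S (S (D (S dl)))) n := by
  rw [← P_dl, transport _ _ (S_zero _), transport' _ _ (S_zero _), transport _ _ (D_zero _),
    transport _ _ (S_zero _), transport' _ _ (S_zero _), P_symm, P_dl]

lemma dual23 : ∑' n, D (D (S (D (S dl)))) n = ∑' n, D (S (D (S (S dl)))) n := by
  rw [← P_dl, transport _ _ (D_zero _), transport _ _ (S_zero _), transport' _ _ (S_zero _),
    transport _ _ (S_zero _), transport' _ _ (S_zero _), P_symm, P_dl]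

lemma dual14 : ∑' n, D (D (D (S (S dl)))) n = ∑' n, D (D (S (S (S dl)))) n := by
  rw [← P_dl, transport _ _ (D_zero _), transport _ _ (D_zero _), transport _ _ (S_zero _),
    transport' _ _ (S_zero _), transport' _ _ (D_zero _), P_symm, P_dl]

lemma S_dl : S dl = w := by
  funext n
  cases n with
  | zero => simp [S, w_zero]
  | succ n =>
    unfold S dl
    rw [Finset.sum_ite_eq' ]
    simp

noncomputable def Z2 (i j : ℕ) : ℝ≥0∞ := ∑' a, ∑' b, w (a + 1) ^ i * w (a + b + 2) ^ j
noncomputable def Z3 (i j l : ℕ) : ℝ≥0∞ :=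
  ∑' a, ∑' b, ∑' d, w (a + 1) ^ i * w (a + b + 2) ^ j * w (a + b + d + 3) ^ l

lemma tsum_succ (f : ℕ → ℝ≥0∞) (h : f 0 = 0) : ∑' n, f n = ∑' n, f (n + 1) := by
  rw [tsum_split f 1]; simp [h, add_comm]

lemma Z2_eq (i j : ℕ) (hi : i ≠ 0) :
    ∑' n, w n ^ j * ∑ k ∈ Finset.range n, w k ^ i = Z2 i j := by
  rw [L (fun k => w k ^ i) (fun n => w n ^ j), tsum_succ _ (by simp [w_zero, hi])]
  unfold Z2
  refine tsum_congr fun a => ?_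
  rw [ENNReal.tsum_mul_left]
  congr 1
  refine tsum_congr fun b => ?_
  congr 2; omega

lemma Z3_eq (i j l : ℕ) (hi : i ≠ 0) :
    ∑' n, w n ^ l * ∑ k ∈ Finset.range n, w k ^ j * ∑ q ∈ Finset.range k, w q ^ i = Z3 i j l := by
  rw [L (fun k => w k ^ j * ∑ q ∈ Finset.range k, w q ^ i) (fun n => w n ^ l)]
  have : ∀ k, (w k ^ j * ∑ q ∈ Finset.range k, w q ^ i) * ∑' b, w (k + b + 1) ^ l
     = (w k ^ j * ∑' b, w (k + b + 1) ^ l) * ∑ q ∈ Finset.range k, w q ^ i := by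
    intro k; ring
  simp_rw [this]
  rw [L (fun k => w k ^ i) (fun k => w k ^ j * ∑' b, w (k + b + 1) ^ l),
    tsum_succ _ (by simp [w_zero, hi])]
  unfold Z3
  refine tsum_congr fun a => ?_
  rw [← ENNReal.tsum_mul_left]
  refine tsum_congr fun b => ?_
  rw [ENNReal.tsum_mul_left, mul_assoc]
  congr 2
  · congr 2; omega
  · refine tsum_congr fun d => ?_
    congr 2; omega

lemma d32 : Z2 3 2 = Z3 2 1 2 := by
  rw [← Z2_eq _ _ (by norm_num), ← Z3_eq _ _ _ (by norm_num)]
  have := dual32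
  rw [S_dl] at this
  simp only [D, S] at this
  simpa [pow_succ, mul_assoc] using this

lemma d23 : Z2 2 3 = Z3 1 2 2 := by
  rw [← Z2_eq _ _ (by norm_num), ← Z3_eq _ _ _ (by norm_num)]
  have := dual23
  rw [S_dl] at this
  simp only [D, S] at this
  simpa [pow_succ, mul_assoc] using this

lemma d14 : Z2 1 4 = Z3 1 1 3 := by
  rw [← Z2_eq _ _ (by norm_num), ← Z3_eq _ _ _ (by norm_num)]
  have := dual14
  rw [S_dl] at this
  simp only [D, S] at this
  simpa [pow_succ, mul_assoc] using this

noncomputable def z (i : ℕ) : ℝ≥0∞ := ∑' n, w n ^ i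

lemma stuffle : z 2 * z 3 = Z2 2 3 + Z2 3 2 + z 5 := by
  have h : z 2 * z 3 = ∑' n, (w n ^ 2 * ∑ k ∈ Finset.range n, w k ^ 3 + w n ^ 5
      + w n ^ 2 * ∑' b, w (n + b + 1) ^ 3) := by
    unfold z
    rw [← ENNReal.tsum_mul_right]
    refine tsum_congr fun n => ?_
    rw [tsum_split (fun n => w n ^ 3) (n + 1), Finset.sum_range_succ]
    have : ∀ b, n + 1 + b = n + b + 1 := by intro b; omega
    simp_rw [this]
    ring
  rw [h, ENNReal.tsum_add, ENNReal.tsum_add, Z2_eq 3 2 (by norm_num),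
    ← L (fun n => w n ^ 2) (fun n => w n ^ 3), Z2_eq 2 3 (by norm_num)]
  unfold z
  ring

lemma z_succ (i : ℕ) (hi : i ≠ 0) : z i = ∑' n, w (n + 1) ^ i :=
  tsum_succ _ (by simp [w_zero, hi])

lemma Z2_comm (i j : ℕ) : Z2 i j = ∑' a, ∑' b, w (b + 1) ^ i * w (a + b + 2) ^ j := by
  unfold Z2
  rw [ENNReal.tsum_comm]
  refine tsum_congr fun a => tsum_congr fun b => ?_
  rw [add_comm a b]

lemma pf1 (a b : ℕ) : w (a + 1) ^ 2 * w (b + 1) ^ 3 =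
    3 * (w (a + 1) ^ 1 * w (a + b + 2) ^ 4) + w (a + 1) ^ 2 * w (a + b + 2) ^ 3
    + (3 * (w (b + 1) ^ 1 * w (a + b + 2) ^ 4) + 2 * (w (b + 1) ^ 2 * w (a + b + 2) ^ 3)
      + w (b + 1) ^ 3 * w (a + b + 2) ^ 2) := by
  have : ((a + 1 : ℕ) : ℝ≥0)⁻¹ ^ 2 * ((b + 1 : ℕ) : ℝ≥0)⁻¹ ^ 3 =
    3 * (((a + 1 : ℕ) : ℝ≥0)⁻¹ ^ 1 * ((a + b + 2 : ℕ) : ℝ≥0)⁻¹ ^ 4)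
      + ((a + 1 : ℕ) : ℝ≥0)⁻¹ ^ 2 * ((a + b + 2 : ℕ) : ℝ≥0)⁻¹ ^ 3
    + (3 * (((b + 1 : ℕ) : ℝ≥0)⁻¹ ^ 1 * ((a + b + 2 : ℕ) : ℝ≥0)⁻¹ ^ 4)
      + 2 * (((b + 1 : ℕ) : ℝ≥0)⁻¹ ^ 2 * ((a + b + 2 : ℕ) : ℝ≥0)⁻¹ ^ 3)
      + ((b + 1 : ℕ) : ℝ≥0)⁻¹ ^ 3 * ((a + b + 2 : ℕ) : ℝ≥0)⁻¹ ^ 2) := by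
    rw [← NNReal.coe_inj]
    push_cast
    field_simp
    ring
  unfold w
  exact_mod_cast congrArg ((↑) : ℝ≥0 → ℝ≥0∞) this

lemma pf2 (a b : ℕ) : w (a + 1) ^ 3 * (w (b + 1) * w (a + b + 2)) =
    w (a + 1) ^ 1 * w (a + b + 2) ^ 4 + w (a + 1) ^ 2 * w (a + b + 2) ^ 3
    + (w (a + 1) ^ 3 * w (a + b + 2) ^ 2 + w (b + 1) ^ 1 * w (a + b + 2) ^ 4) := by
  have : ((a + 1 : ℕ) : ℝ≥0)⁻¹ ^ 3 * (((b + 1 : ℕ) : ℝ≥0)⁻¹ * ((a + b + 2 : ℕ) : ℝ≥0)⁻¹) =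
    ((a + 1 : ℕ) : ℝ≥0)⁻¹ ^ 1 * ((a + b + 2 : ℕ) : ℝ≥0)⁻¹ ^ 4
      + ((a + 1 : ℕ) : ℝ≥0)⁻¹ ^ 2 * ((a + b + 2 : ℕ) : ℝ≥0)⁻¹ ^ 3
    + (((a + 1 : ℕ) : ℝ≥0)⁻¹ ^ 3 * ((a + b + 2 : ℕ) : ℝ≥0)⁻¹ ^ 2
      + ((b + 1 : ℕ) : ℝ≥0)⁻¹ ^ 1 * ((a + b + 2 : ℕ) : ℝ≥0)⁻¹ ^ 4) := by
    rw [← NNReal.coe_inj]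
    push_cast
    field_simp
    ring
  unfold w
  exact_mod_cast congrArg ((↑) : ℝ≥0 → ℝ≥0∞) this

lemma shuffle : z 2 * z 3 = 3 * Z2 1 4 + Z2 2 3 + (3 * Z2 1 4 + 2 * Z2 2 3 + Z2 3 2) := by
  rw [z_succ 2 (by norm_num), z_succ 3 (by norm_num), ← ENNReal.tsum_mul_right]
  simp_rw [← ENNReal.tsum_mul_left]
  rw [tsum_congr fun a => tsum_congr fun b => pf1 a b]
  simp_rw [ENNReal.tsum_add, ENNReal.tsum_mul_left (a := 3),
    ENNReal.tsum_mul_left (a := 2), ← Z2_comm]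
  rfl

lemma harm_real (n : ℕ) : HasSum (fun b : ℕ => ((b : ℝ) + 1)⁻¹ - ((b : ℝ) + 1 + n)⁻¹)
    (∑ k ∈ Finset.range n, ((k : ℝ) + 1)⁻¹) := by
  induction n with
  | zero => simpa using hasSum_zero
  | succ n ih =>
    rw [Finset.sum_range_succ]
    have h : HasSum (fun b : ℕ => ((b : ℝ) + 1 + n)⁻¹ - (((b + 1 : ℕ) : ℝ) + 1 + n)⁻¹)
        (((0 : ℕ) : ℝ) + 1 + n)⁻¹ := by
      apply hasSum_tele (fun b : ℕ => ((b : ℝ) + 1 + n)⁻¹)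
      · apply antitone_nat_of_succ_le
        intro b
        apply inv_anti₀ (by positivity)
        push_cast; linarith
      · have h3 := (tendsto_add_atTop_iff_nat (f := fun b : ℕ => ((b : ℝ) + 1)⁻¹) n).2
          (by simpa [one_div] using tendsto_one_div_add_atTop_nhds_zero_nat (𝕜 := ℝ))
        refine h3.congr fun b => ?_
        push_cast; ring_nf
    convert ih.add h using 1
    · funext b
      push_cast
      ring
    · push_cast; ring

lemma harm (a : ℕ) : ∑' b, w (b + 1) * w (a + b + 2) =
    w (a + 1) * ∑ k ∈ Finset.range (a + 2), w k := by
  have h := (harm_real (a + 1)).mul_left ((a : ℝ) + 1)⁻¹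
  have hs2 : HasSum (fun b : ℕ => ((b + 1 : ℕ) : ℝ≥0)⁻¹ * ((a + b + 2 : ℕ) : ℝ≥0)⁻¹)
      (((a + 1 : ℕ) : ℝ≥0)⁻¹ * ∑ k ∈ Finset.range (a + 1), ((k + 1 : ℕ) : ℝ≥0)⁻¹) := by
    rw [← NNReal.hasSum_coe]
    have ef : (fun b : ℕ => ((((b + 1 : ℕ) : ℝ≥0)⁻¹ * ((a + b + 2 : ℕ) : ℝ≥0)⁻¹ : ℝ≥0) : ℝ)) =
        fun b : ℕ => ((a : ℝ) + 1)⁻¹ * (((b : ℝ) + 1)⁻¹ - ((b : ℝ) + 1 + ((a + 1 : ℕ) : ℝ))⁻¹) := by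
      funext b
      push_cast
      field_simp
      ring
    rw [ef]
    have eg : (((((a + 1 : ℕ) : ℝ≥0)⁻¹ * ∑ k ∈ Finset.range (a + 1), ((k + 1 : ℕ) : ℝ≥0)⁻¹ : ℝ≥0)) : ℝ)
        = ((a : ℝ) + 1)⁻¹ * ∑ k ∈ Finset.range (a + 1), ((k : ℝ) + 1)⁻¹ := by
      push_cast; rfl
    rw [eg]
    exact h
  have := (ENNReal.hasSum_coe.2 hs2).tsum_eq
  rw [Finset.sum_range_succ', w_zero, add_zero]
  simp only [ENNReal.coe_mul, ENNReal.ofNNReal_finsetSum] at this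
  exact this

lemma sumformula : Z2 1 4 + z 5 = Z2 1 4 + Z2 2 3 + (Z2 3 2 + Z2 1 4) := by
  have h1 : ∑' a, ∑' b, w (a + 1) ^ 3 * (w (b + 1) * w (a + b + 2)) = Z2 1 4 + z 5 := by
    simp_rw [ENNReal.tsum_mul_left, harm]
    rw [← Z2_eq 1 4 (by norm_num), z, ← ENNReal.tsum_add,
      tsum_succ (fun n => w n ^ 4 * ∑ k ∈ Finset.range n, w k ^ 1 + w n ^ 5) (by simp [w_zero])]
    refine tsum_congr fun a => ?_
    rw [Finset.sum_range_succ]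
    simp only [pow_one]
    ring
  rw [← h1]
  simp_rw [pf2, ENNReal.tsum_add, ← Z2_comm]
  rfl

lemma z_fin (i : ℕ) (hi : 1 < i) : z i ≠ ∞ := by
  have h : Summable (fun n : ℕ => ((n : ℝ≥0)⁻¹) ^ i) := by
    rw [← NNReal.summable_coe]
    push_cast
    simpa using (Real.summable_nat_pow_inv (p := i)).2 hi
  have := ENNReal.tsum_coe_ne_top_iff_summable.2 h
  unfold z w
  exact_mod_cast this

lemma fin23 : Z2 2 3 ≠ ∞ ∧ Z2 3 2 ≠ ∞ ∧ z 5 ≠ ∞ := by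
  have h := stuffle ▸ ENNReal.mul_ne_top (z_fin 2 (by norm_num)) (z_fin 3 (by norm_num))
  simpa [ENNReal.add_eq_top, and_assoc] using h

lemma fin14 : Z2 1 4 ≠ ∞ := by
  have h := shuffle ▸ ENNReal.mul_ne_top (z_fin 2 (by norm_num)) (z_fin 3 (by norm_num))
  intro h0
  apply h
  simp [h0]

lemma main : (Z2 3 2).toReal = (Z2 2 3).toReal + 5 * (Z2 1 4).toReal := by
  obtain ⟨h1, h2, h3⟩ := fin23
  have h4 := fin14
  have e1 := shuffle.symm.trans stuffle
  have e2 := sumformula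
  lift Z2 2 3 to ℝ≥0 using h1 with x
  lift Z2 3 2 to ℝ≥0 using h2 with y
  lift z 5 to ℝ≥0 using h3 with t
  lift Z2 1 4 to ℝ≥0 using h4 with v
  have e1' : 3 * v + x + (3 * v + 2 * x + y) = x + y + t := by exact_mod_cast e1
  have e2' : v + t = v + x + (y + v) := by exact_mod_cast e2
  have e1'' := congrArg ((↑) : ℝ≥0 → ℝ) e1'
  have e2'' := congrArg ((↑) : ℝ≥0 → ℝ) e2'
  push_cast at e1'' e2''
  simp only [ENNReal.coe_toReal]
  linarith

def e2 : ℕ × ℕ ≃ {f : Fin 2 → ℕ+ // StrictMono f} where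
  toFun p := ⟨![⟨p.1 + 1, by omega⟩, ⟨p.1 + p.2 + 2, by omega⟩], by
    rw [Fin.strictMono_iff_lt_succ]
    intro i
    fin_cases i
    change p.1 + 1 < p.1 + p.2 + 2
    omega⟩
  invFun f := ((f.1 0 : ℕ) - 1, (f.1 1 : ℕ) - (f.1 0 : ℕ) - 1)
  left_inv p := by
    ext
    · change p.1 + 1 - 1 = p.1
      omega
    · change p.1 + p.2 + 2 - (p.1 + 1) - 1 = p.2
      omega
  right_inv f := by
    have h0 : 0 < (f.1 0 : ℕ) := (f.1 0).pos
    have h1 : (f.1 0 : ℕ) < (f.1 1 : ℕ) := f.2 (by decide : (0 : Fin 2) < 1)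
    apply Subtype.ext
    funext i
    apply PNat.eq
    fin_cases i
    · change (f.1 0 : ℕ) - 1 + 1 = (f.1 0 : ℕ)
      omega
    · change (f.1 0 : ℕ) - 1 + ((f.1 1 : ℕ) - (f.1 0 : ℕ) - 1) + 2 = (f.1 1 : ℕ)
      omega

def e3 : ℕ × ℕ × ℕ ≃ {f : Fin 3 → ℕ+ // StrictMono f} where
  toFun p := ⟨![⟨p.1 + 1, by omega⟩, ⟨p.1 + p.2.1 + 2, by omega⟩,
      ⟨p.1 + p.2.1 + p.2.2 + 3, by omega⟩], by
    rw [Fin.strictMono_iff_lt_succ]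
    intro i
    fin_cases i
    · change p.1 + 1 < p.1 + p.2.1 + 2
      omega
    · change p.1 + p.2.1 + 2 < p.1 + p.2.1 + p.2.2 + 3
      omega⟩
  invFun f := ((f.1 0 : ℕ) - 1, (f.1 1 : ℕ) - (f.1 0 : ℕ) - 1, (f.1 2 : ℕ) - (f.1 1 : ℕ) - 1)
  left_inv p := by
    ext
    · change p.1 + 1 - 1 = p.1
      omega
    · change p.1 + p.2.1 + 2 - (p.1 + 1) - 1 = p.2.1
      omega
    · change p.1 + p.2.1 + p.2.2 + 3 - (p.1 + p.2.1 + 2) - 1 = p.2.2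
      omega
  right_inv f := by
    have h0 : 0 < (f.1 0 : ℕ) := (f.1 0).pos
    have h1 : (f.1 0 : ℕ) < (f.1 1 : ℕ) := f.2 (by decide : (0 : Fin 3) < 1)
    have h2 : (f.1 1 : ℕ) < (f.1 2 : ℕ) := f.2 (by decide : (1 : Fin 3) < 2)
    apply Subtype.ext
    funext i
    apply PNat.eq
    fin_cases i
    · change (f.1 0 : ℕ) - 1 + 1 = (f.1 0 : ℕ)
      omega
    · change (f.1 0 : ℕ) - 1 + ((f.1 1 : ℕ) - (f.1 0 : ℕ) - 1) + 2 = (f.1 1 : ℕ)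
      omega
    · change (f.1 0 : ℕ) - 1 + ((f.1 1 : ℕ) - (f.1 0 : ℕ) - 1)
        + ((f.1 2 : ℕ) - (f.1 1 : ℕ) - 1) + 3 = (f.1 2 : ℕ)
      omega

lemma w_ne_top (n : ℕ) : w n ≠ ∞ := ENNReal.coe_ne_top

lemma w_toReal (n : ℕ) : (w n).toReal = (n : ℝ)⁻¹ := by simp [w]

lemma mzv2 (i j : ℕ) : mzv [i, j] = (Z2 i j).toReal := by
  have h : Z2 i j = ∑' p : ℕ × ℕ, w (p.1 + 1) ^ i * w (p.1 + p.2 + 2) ^ j := by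
    rw [ENNReal.tsum_prod']; rfl
  rw [h, ENNReal.tsum_toReal_eq (fun p => ENNReal.mul_ne_top (ENNReal.pow_ne_top (w_ne_top _))
    (ENNReal.pow_ne_top (w_ne_top _)))]
  unfold mzv
  refine (Equiv.tsum_eq e2 _).symm.trans ?_
  refine tsum_congr fun p => ?_
  refine (Fin.prod_univ_two _).trans ?_
  rw [ENNReal.toReal_mul, ENNReal.toReal_pow, ENNReal.toReal_pow, w_toReal, w_toReal,
    inv_pow, inv_pow]
  rfl

lemma mzv3 (i j l : ℕ) : mzv [i, j, l] = (Z3 i j l).toReal := by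
  have h : Z3 i j l = ∑' p : ℕ × ℕ × ℕ, w (p.1 + 1) ^ i * w (p.1 + p.2.1 + 2) ^ j
      * w (p.1 + p.2.1 + p.2.2 + 3) ^ l := by
    rw [ENNReal.tsum_prod']
    simp_rw [ENNReal.tsum_prod']
    rfl
  rw [h, ENNReal.tsum_toReal_eq (fun p => ENNReal.mul_ne_top (ENNReal.mul_ne_top
    (ENNReal.pow_ne_top (w_ne_top _)) (ENNReal.pow_ne_top (w_ne_top _)))
    (ENNReal.pow_ne_top (w_ne_top _)))]
  unfold mzv
  refine (Equiv.tsum_eq e3 _).symm.trans ?_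
  refine tsum_congr fun p => ?_
  refine (Fin.prod_univ_three _).trans ?_
  rw [ENNReal.toReal_mul, ENNReal.toReal_mul, ENNReal.toReal_pow, ENNReal.toReal_pow,
    ENNReal.toReal_pow, w_toReal, w_toReal, w_toReal, inv_pow, inv_pow, inv_pow]
  rfl

end MzvAux

theorem mzv_rel_15 :
    -2 * mzv [1,4] - mzv [2,3] - 3 * mzv [1,1,3] + mzv [2,1,2] = 0 ∧
    2 * mzv [1,4] - mzv [3,2] + 3 * mzv [1,1,3] + mzv [1,2,2] = 0 := by
  simp only [MzvAux.mzv2, MzvAux.mzv3, ← MzvAux.d32, ← MzvAux.d23, ← MzvAux.d14]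
  have := MzvAux.main
  constructor <;> linarith
end

section
/- The weight-6 multiple zeta values satisfy ζ(6) = ζ(1,1,1,1,2) and 16ζ(2,2,2) = 3ζ(1,1,1,1,2). -/
open scoped ENNReal

theorem tsum_fin_succ (n : ℕ) (g : (Fin (n+1) → ℕ+) → ℝ≥0∞) :
    ∑' f, g f = ∑' a : ℕ+, ∑' f : Fin n → ℕ+, g (Matrix.vecCons a f) := by
  rw [← (Fin.consEquiv (fun _ : Fin (n+1) => ℕ+)).tsum_eq, ENNReal.tsum_prod']
  rfl

theorem tsum_fin_zero (g : (Fin 0 → ℕ+) → ℝ≥0∞) : ∑' f, g f = g ![] :=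
  tsum_eq_single _ (fun _ hb => absurd (Subsingleton.elim _ _) hb)

open Classical in
theorem mzv_eq (k : List ℕ) : mzv k = (∑' f : Fin k.length → ℕ+,
    if StrictMono f then ∏ i, ((f i : ℝ≥0∞) ^ (k.get i))⁻¹ else 0).toReal := by
  unfold mzv
  have h := tsum_subtype (s := {f : Fin k.length → ℕ+ | StrictMono f})
    (f := fun f => ∏ i, ((f i : ℝ≥0∞) ^ (k.get i))⁻¹)
  simp only [Set.indicator_apply, Set.mem_ofPred_eq] at h
  have hne : ∀ (n : ℕ+) (j : ℕ), ((n : ℝ≥0∞) ^ j)⁻¹ ≠ ⊤ := by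
    intro n j
    simp
  rw [← h, ENNReal.tsum_toReal_eq]
  · refine tsum_congr fun m => ?_
    rw [ENNReal.toReal_prod]
    refine Finset.prod_congr rfl fun i _ => ?_
    simp
  · intro m
    exact ENNReal.prod_ne_top fun i _ => hne _ _

/-- reciprocal of a positive integer -/
noncomputable def rc (a : ℕ+) : ℝ≥0∞ := (a : ℝ≥0∞)⁻¹

theorem mzv6 : mzv [6] = (∑' a, rc a ^ 6).toReal := by
  rw [mzv_eq]
  congr 1
  refine (tsum_fin_succ _ _).trans ?_
  refine tsum_congr fun a => ?_
  refine (tsum_fin_zero _).trans ?_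
  simp [rc, ENNReal.inv_pow, Subsingleton.strictMono]

open Classical in
theorem mzv222 : mzv [2,2,2] = (∑' a, ∑' b, ∑' c, if a < b ∧ b < c then
    rc a ^ 2 * rc b ^ 2 * rc c ^ 2 else 0).toReal := by
  rw [mzv_eq]
  congr 1
  refine (tsum_fin_succ _ _).trans ?_
  refine tsum_congr fun a => ?_
  refine (tsum_fin_succ _ _).trans ?_
  refine tsum_congr fun b => ?_
  refine (tsum_fin_succ _ _).trans ?_
  refine tsum_congr fun c => ?_
  refine (tsum_fin_zero _).trans ?_
  congr 1
  · simp [Fin.strictMono_iff_lt_succ, Fin.forall_fin_succ]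
  · simp [rc, ENNReal.inv_pow, Fin.prod_univ_succ, mul_assoc]

open Classical in
theorem mzv11112 : mzv [1,1,1,1,2] = (∑' a, ∑' b, ∑' c, ∑' d, ∑' e,
    if a < b ∧ b < c ∧ c < d ∧ d < e then
    rc a * rc b * rc c * rc d * rc e ^ 2 else 0).toReal := by
  rw [mzv_eq]
  congr 1
  refine (tsum_fin_succ _ _).trans ?_
  refine tsum_congr fun a => ?_
  refine (tsum_fin_succ _ _).trans ?_
  refine tsum_congr fun b => ?_
  refine (tsum_fin_succ _ _).trans ?_
  refine tsum_congr fun c => ?_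
  refine (tsum_fin_succ _ _).trans ?_
  refine tsum_congr fun d => ?_
  refine (tsum_fin_succ _ _).trans ?_
  refine tsum_congr fun e => ?_
  refine (tsum_fin_zero _).trans ?_
  congr 1
  · simp [Fin.strictMono_iff_lt_succ, Fin.forall_fin_succ]
  · simp [rc, ENNReal.inv_pow, Fin.prod_univ_succ, mul_assoc]

/-- the connector, real valued -/
noncomputable def cr (n m : ℕ) : ℝ := ((n + m).choose n : ℝ)⁻¹

theorem cr_nonneg (n m : ℕ) : 0 ≤ cr n m := by unfold cr; positivity

theorem cr_step (n m : ℕ) (hn : 0 < n) :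
    cr n (m+1) / (m+1 : ℕ) = cr n m / n - cr n (m+1) / n := by
  have h := Nat.add_one_mul_choose_eq (n + m) m
  have e1 : (n + m).choose m = (n+m).choose n := Nat.choose_symm_add.symm
  have e2 : (n + m).succ.choose m.succ = (n+(m+1)).choose n :=
    (Nat.choose_symm_add (a := n) (b := m+1)).symm
  rw [e1, e2] at h
  have h' : ((n:ℝ) + m + 1) * ((n+m).choose n : ℝ) = ((n+(m+1)).choose n : ℝ) * (m+1) := by
    exact_mod_cast h
  have p1 : (0:ℝ) < ((n+m).choose n : ℝ) := by
    exact_mod_cast Nat.choose_pos (Nat.le_add_right n m)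
  have p2 : (0:ℝ) < ((n+(m+1)).choose n : ℝ) := by
    exact_mod_cast Nat.choose_pos (Nat.le_add_right n (m+1))
  have hn' : (0:ℝ) < n := by exact_mod_cast hn
  unfold cr
  push_cast
  field_simp
  linarith

theorem cr_le (n m : ℕ) (hn : 0 < n) : cr n m ≤ 1 / ((m:ℝ) + 1) := by
  have : m + 1 ≤ (n + m).choose n := by
    rw [Nat.choose_symm_add]
    calc m + 1 = (1 + m).choose m := by rw [add_comm 1 m, Nat.choose_succ_self_right]
      _ ≤ _ := Nat.choose_le_choose m (by omega)
  unfold cr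
  rw [← one_div]
  apply one_div_le_one_div_of_le (by positivity)
  exact_mod_cast this

theorem cr_tendsto (n : ℕ) (hn : 0 < n) :
    Filter.Tendsto (fun m => cr n m) Filter.atTop (nhds 0) :=
  squeeze_zero (fun m => cr_nonneg n m) (fun m => cr_le n m hn) tendsto_one_div_add_atTop_nhds_zero_nat

theorem cr_hasSum (n m : ℕ) (hn : 0 < n) :
    HasSum (fun j : ℕ => cr n (m+j+1) / (m+j+1 : ℕ)) (cr n m / n) := by
  rw [hasSum_iff_tendsto_nat_of_nonneg]
  · have : ∀ N, ∑ j ∈ Finset.range N, cr n (m+j+1) / (m+j+1 : ℕ) = cr n m / n - cr n (m+N) / n := by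
      intro N
      induction N with
      | zero => simp
      | succ N ih =>
        rw [Finset.sum_range_succ, ih, cr_step n (m+N) hn]
        rw [← add_assoc]; ring
    simp_rw [this]
    have h := ((cr_tendsto n hn).comp (Filter.tendsto_add_atTop_nat m)).div_const (n:ℝ)
    have h2 := h.const_sub (cr n m / n)
    simpa [Function.comp_def, add_comm m] using h2
  · intro j
    exact div_nonneg (cr_nonneg _ _) (by positivity)

/-- the connector -/
noncomputable def cn (n m : ℕ) : ℝ≥0∞ := ENNReal.ofReal (cr n m)

theorem cn_comm (n m : ℕ) : cn n m = cn m n := by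
  unfold cn cr
  rw [Nat.choose_symm_add, add_comm]

theorem cn_zero (n : ℕ) : cn n 0 = 1 := by simp [cn, cr]

theorem rc_eq (a : ℕ+) : rc a = ENNReal.ofReal ((a : ℕ) : ℝ)⁻¹ := by
  rw [ENNReal.ofReal_inv_of_pos (by exact_mod_cast a.pos)]
  simp [rc]

theorem cn_sum (n : ℕ+) (m : ℕ) :
    ∑' a : ℕ+, (if m < (a : ℕ) then rc a * cn n a else 0) = rc n * cn n m := by
  have h := cr_hasSum n m n.pos
  have h1 : ∑' j : ℕ, ENNReal.ofReal (cr n (m+j+1) / (m+j+1 : ℕ)) = rc n * cn n m := by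
    rw [← ENNReal.ofReal_tsum_of_nonneg _ h.summable, h.tsum_eq, rc_eq, cn,
      ← ENNReal.ofReal_mul (by positivity), div_eq_inv_mul]
    intro j
    exact div_nonneg (cr_nonneg _ _) (by positivity)
  rw [← h1]
  have hinj : Function.Injective (fun j : ℕ => Nat.succPNat (m+j)) := by
    intro i j hij
    have := congrArg PNat.val hij
    simp at this
    exact this
  rw [← hinj.tsum_eq]
  · refine tsum_congr fun j => ?_
    have : m < m + j + 1 := by omega
    simp only [Nat.succPNat_coe, Nat.succ_eq_add_one, this, if_true, rc_eq, cn]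
    rw [← ENNReal.ofReal_mul (by positivity), div_eq_inv_mul]
  · intro a ha
    have hm : m < (a : ℕ) := by
      by_contra hc
      simp [hc] at ha
    refine ⟨(a : ℕ) - m - 1, ?_⟩
    apply PNat.eq
    simp
    omega

theorem cn_sum_zero (e : ℕ+) : ∑' n : ℕ+, rc n * cn n e = rc e := by
  have h := cn_sum e 0
  rw [cn_zero, mul_one] at h
  rw [← h]
  refine tsum_congr fun n => ?_
  rw [if_pos n.pos, cn_comm]

theorem cn_sum_pos (n d : ℕ+) (x : ℝ≥0∞) :
    ∑' a : ℕ+, (if d < a then x * rc a * cn n a else 0) = x * rc n * cn n d := by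
  have h := cn_sum n d
  rw [mul_assoc, ← h, ← ENNReal.tsum_mul_left]
  refine tsum_congr fun a => ?_
  simp only [PNat.coe_lt_coe, mul_ite, mul_zero, mul_assoc]

theorem cn_sum_all (n : ℕ+) : ∑' a : ℕ+, rc a * cn n a = rc n := by
  rw [← cn_sum_zero n]
  exact tsum_congr fun a => by rw [cn_comm]

theorem duality : (∑' a, ∑' b, ∑' c, ∑' d, ∑' e,
    if a < b ∧ b < c ∧ c < d ∧ d < e then
    rc a * rc b * rc c * rc d * rc e ^ 2 else 0) = ∑' n, rc n ^ 6 := by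
  have key : ∀ a b c d e : ℕ+, (if a < b ∧ b < c ∧ c < d ∧ d < e then
      rc a * rc b * rc c * rc d * rc e ^ 2 else 0) =
      ∑' n : ℕ+, if a < b then if b < c then if c < d then if d < e then
        (rc n * rc a * rc b * rc c * rc d) * rc e * cn n e else 0 else 0 else 0 else 0 := by
    intro a b c d e
    by_cases h1 : a < b <;> by_cases h2 : b < c <;> by_cases h3 : c < d <;>
      by_cases h4 : d < e <;> simp only [h1, h2, h3, h4, and_self, and_true, and_false, true_and,
        false_and, if_true, if_false, tsum_zero]
    rw [sq, ← mul_assoc]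
    nth_rewrite 2 [← cn_sum_zero e]
    rw [← ENNReal.tsum_mul_left]
    exact tsum_congr fun n => by ring
  simp_rw [key]
  have pull : ∀ (p : Prop) [Decidable p] (f : ℕ+ → ℝ≥0∞),
      ∑' e, (if p then f e else 0) = if p then ∑' e, f e else 0 := by
    intro p _ f
    split_ifs <;> simp
  have s1 : ∀ a b c d : ℕ+, (∑' e : ℕ+, ∑' n : ℕ+, if a < b then if b < c then if c < d then
      if d < e then (rc n * rc a * rc b * rc c * rc d) * rc e * cn n e else 0 else 0 else 0 else 0)
      = ∑' n : ℕ+, if a < b then if b < c then if c < d then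
        (rc n ^ 2 * rc a * rc b * rc c) * rc d * cn n d else 0 else 0 else 0 := by
    intro a b c d
    rw [ENNReal.tsum_comm]
    refine tsum_congr fun n => ?_
    rw [pull, pull, pull, cn_sum_pos]
    congr 3
    ring
  have s2 : ∀ a b c : ℕ+, (∑' d : ℕ+, ∑' n : ℕ+, if a < b then if b < c then if c < d then
        (rc n ^ 2 * rc a * rc b * rc c) * rc d * cn n d else 0 else 0 else 0)
      = ∑' n : ℕ+, if a < b then if b < c then
        (rc n ^ 3 * rc a * rc b) * rc c * cn n c else 0 else 0 := by
    intro a b c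
    rw [ENNReal.tsum_comm]
    refine tsum_congr fun n => ?_
    rw [pull, pull, cn_sum_pos]
    congr 2
    ring
  have s3 : ∀ a b : ℕ+, (∑' c : ℕ+, ∑' n : ℕ+, if a < b then if b < c then
        (rc n ^ 3 * rc a * rc b) * rc c * cn n c else 0 else 0)
      = ∑' n : ℕ+, if a < b then
        (rc n ^ 4 * rc a) * rc b * cn n b else 0 := by
    intro a b
    rw [ENNReal.tsum_comm]
    refine tsum_congr fun n => ?_
    rw [pull, cn_sum_pos]
    congr 1
    ring
  have s4 : ∀ a : ℕ+, (∑' b : ℕ+, ∑' n : ℕ+, if a < b then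
        (rc n ^ 4 * rc a) * rc b * cn n b else 0)
      = ∑' n : ℕ+, rc n ^ 5 * (rc a * cn n a) := by
    intro a
    rw [ENNReal.tsum_comm]
    refine tsum_congr fun n => ?_
    rw [cn_sum_pos]
    ring
  simp_rw [s1, s2, s3, s4]
  rw [ENNReal.tsum_comm]
  refine tsum_congr fun n => ?_
  rw [ENNReal.tsum_mul_left, cn_sum_all]
  ring

theorem newton (x : ℕ+ → ℝ≥0∞) :
    (∑' a, x a) ^ 3 + 2 * ∑' a, x a ^ 3 =
      6 * (∑' a, ∑' b, ∑' c, if a < b ∧ b < c then x a * x b * x c else 0)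
      + 3 * ((∑' a, x a) * ∑' a, x a ^ 2) := by
  set E := (∑' a, ∑' b, ∑' c, if a < b ∧ b < c then x a * x b * x c else 0) with hE
  have hcube : (∑' a, x a) ^ 3 = ∑' a, ∑' b, ∑' c, x a * x b * x c := by
    simp_rw [ENNReal.tsum_mul_left, ENNReal.tsum_mul_right, ENNReal.tsum_mul_left,
      ENNReal.tsum_mul_right]
    ring
  have hp3 : ∑' a, x a ^ 3 = ∑' a, ∑' b, ∑' c, if a = b ∧ b = c then x a * x b * x c else 0 := by
    refine tsum_congr fun a => ?_
    rw [tsum_eq_single a (fun b hb => by simp [hb.symm]),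
      tsum_eq_single a (fun b hb => by simp [hb.symm])]
    simp; ring
  have q1 : (∑' a, x a) * ∑' a, x a ^ 2 =
      ∑' a, ∑' b, ∑' c, if b = c then x a * x b * x c else 0 := by
    rw [← ENNReal.tsum_mul_right]
    refine tsum_congr fun a => ?_
    rw [← ENNReal.tsum_mul_left]
    refine tsum_congr fun b => ?_
    rw [tsum_eq_single b (fun c hc => by simp [hc.symm])]
    simp; ring
  have q2 : (∑' a, x a) * ∑' a, x a ^ 2 =
      ∑' a, ∑' b, ∑' c, if a = c then x a * x b * x c else 0 := by
    rw [q1, ENNReal.tsum_comm]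
    refine tsum_congr fun a => tsum_congr fun b => tsum_congr fun c => ?_
    rw [mul_comm (x a)]
  have q3 : (∑' a, x a) * ∑' a, x a ^ 2 =
      ∑' a, ∑' b, ∑' c, if a = b then x a * x b * x c else 0 := by
    rw [q2]
    refine tsum_congr fun a => ?_
    rw [ENNReal.tsum_comm]
    refine tsum_congr fun b => tsum_congr fun c => ?_
    rw [mul_right_comm]
  have e2 : E = ∑' a, ∑' b, ∑' c, if b < a ∧ a < c then x a * x b * x c else 0 := by
    rw [hE, ENNReal.tsum_comm]
    refine tsum_congr fun a => tsum_congr fun b => tsum_congr fun c => ?_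
    rw [mul_comm (x a)]
  have e3 : E = ∑' a, ∑' b, ∑' c, if a < c ∧ c < b then x a * x b * x c else 0 := by
    rw [hE]
    refine tsum_congr fun a => ?_
    rw [ENNReal.tsum_comm]
    refine tsum_congr fun b => tsum_congr fun c => ?_
    rw [mul_right_comm]
  have e4 : E = ∑' a, ∑' b, ∑' c, if b < c ∧ c < a then x a * x b * x c else 0 := by
    rw [e3, ENNReal.tsum_comm]
    refine tsum_congr fun a => tsum_congr fun b => tsum_congr fun c => ?_
    rw [mul_comm (x a)]
  have e5 : E = ∑' a, ∑' b, ∑' c, if c < a ∧ a < b then x a * x b * x c else 0 := by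
    rw [e2]
    refine tsum_congr fun a => ?_
    rw [ENNReal.tsum_comm]
    refine tsum_congr fun b => tsum_congr fun c => ?_
    rw [mul_right_comm]
  have e6 : E = ∑' a, ∑' b, ∑' c, if c < b ∧ b < a then x a * x b * x c else 0 := by
    rw [e5, ENNReal.tsum_comm]
    refine tsum_congr fun a => tsum_congr fun b => tsum_congr fun c => ?_
    rw [mul_comm (x a)]
  have r1 : 6 * E = E + E + E + E + E + E := by ring
  have r2 : ∀ P : ℝ≥0∞, 3 * P = P + P + P := fun P => by ring
  rw [r1, r2, two_mul]
  nth_rewrite 2 [e2]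
  nth_rewrite 2 [e3]
  nth_rewrite 2 [e4]
  nth_rewrite 2 [e5]
  nth_rewrite 2 [e6]
  nth_rewrite 1 [q1]
  nth_rewrite 1 [q2]
  rw [q3, hE, hcube, hp3]
  simp_rw [← ENNReal.tsum_add]
  refine tsum_congr fun a => tsum_congr fun b => tsum_congr fun c => ?_
  generalize x a * x b * x c = w
  rcases lt_trichotomy a b with h1 | h1 | h1 <;> rcases lt_trichotomy b c with h2 | h2 | h2 <;>
    rcases lt_trichotomy a c with h3 | h3 | h3 <;>
    first
    | (exfalso; subst_vars; order)
    | (subst_vars; simp [*, h1.not_gt, h2.not_gt, h3.not_gt, h1.ne, h2.ne, h3.ne, h1.ne', h2.ne', h3.ne']; done)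
    | (subst_vars; simp_all [not_lt_of_gt, ne_of_gt, ne_of_lt, add_assoc]; done)

theorem pnat_sum (k : ℕ) (hk : k ≠ 0) (v : ℝ) (h : HasSum (fun n : ℕ => 1 / (n:ℝ) ^ k) v) :
    ∑' a, rc a ^ k = ENNReal.ofReal v := by
  rw [← h.tsum_eq, ENNReal.ofReal_tsum_of_nonneg (fun n => by positivity) h.summable]
  rw [← PNat.coe_injective.tsum_eq]
  · refine tsum_congr fun a => ?_
    rw [rc_eq, ← ENNReal.ofReal_pow (by positivity), one_div, inv_pow]
  · intro n hn
    have : n ≠ 0 := by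
      rintro rfl
      simp [hk] at hn
    exact ⟨⟨n, Nat.pos_of_ne_zero this⟩, rfl⟩

theorem zeta6 : HasSum (fun n : ℕ => 1 / (n:ℝ) ^ 6) (Real.pi ^ 6 / 945) := by
  have h := hasSum_zeta_nat (k := 3) (by norm_num)
  have b : bernoulli 6 = 1 / 42 := by
    rw [bernoulli_eq_bernoulli'_of_ne_one (by norm_num)]
    have b5 : bernoulli' 5 = 0 := by
      rw [bernoulli'_def]
      norm_num [Finset.sum_range_succ, Nat.choose]
    rw [bernoulli'_def]
    norm_num [Finset.sum_range_succ, Nat.choose, b5]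
  norm_num [b, Nat.factorial] at h
  convert h using 1
  · simp
  · ring

theorem mzv_rel_19 :
    mzv [6] = mzv [1,1,1,1,2] ∧ 16 * mzv [2,2,2] = 3 * mzv [1,1,1,1,2] := by
  have hd : mzv [6] = mzv [1,1,1,1,2] := by
    rw [mzv6, mzv11112, ← duality]
  refine ⟨hd, ?_⟩
  rw [← hd, mzv6, mzv222, pnat_sum 6 (by norm_num) _ zeta6]
  have hN := newton (fun a => rc a ^ 2)
  simp only [← pow_mul] at hN
  norm_num only at hN
  rw [pnat_sum 2 (by norm_num) _ hasSum_zeta_two, pnat_sum 4 (by norm_num) _ hasSum_zeta_four,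
    pnat_sum 6 (by norm_num) _ zeta6] at hN
  have hE : (∑' a, ∑' b, ∑' c, if a < b ∧ b < c then rc a ^ 2 * rc b ^ 2 * rc c ^ 2 else 0) ≠ ⊤ := by
    intro hc
    rw [hc] at hN
    have : ENNReal.ofReal (Real.pi ^ 2 / 6) ^ 3 + 2 * ENNReal.ofReal (Real.pi ^ 6 / 945) ≠ ⊤ := by
      finiteness
    apply this
    rw [hN]
    simp
  have hT := congrArg ENNReal.toReal hN
  rw [ENNReal.toReal_add (by finiteness) (by finiteness),
    ENNReal.toReal_add (ENNReal.mul_ne_top (by finiteness) hE) (by finiteness)] at hT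
  simp only [ENNReal.toReal_mul, ENNReal.toReal_pow] at hT
  rw [ENNReal.toReal_ofReal (by positivity), ENNReal.toReal_ofReal (by positivity),
    ENNReal.toReal_ofReal (by positivity)] at hT
  rw [ENNReal.toReal_ofReal (by positivity)]
  norm_num at hT
  have hfin : ∀ e : ℝ, (Real.pi ^ 2 / 6) ^ 3 + 2 * (Real.pi ^ 6 / 945) = 6 * e +
      3 * (Real.pi ^ 2 / 6 * (Real.pi ^ 4 / 90)) → 16 * e = 3 * (Real.pi ^ 6 / 945) := by
    intro e he
    ring_nf at he ⊢
    linarith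
  apply hfin
  convert hT using 5
end
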